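/- (Liebscher–Rio inequality.) Let {Z_{i,T} : 1 ≤ i ≤ T} be a triangular array of real random variables with E Z_{i,T} = 0 and |Z_{i,T}| ≤ b_T almost surely, and let α_T denote its strong mixing coefficients. Then for any ε > 0 and any integer 1 ≤ m_T ≤ T satisfying 4 b_T m_T < ε, P(|Σ_{i=1}^T Z_{i,T}| > ε) ≤ 4 exp(−ε²/(64 σ²_{T,m_T} T/m_T + (8/3) ε b_T m_T)) + 4 α_T(m_T) T/m_T, where σ²_{T,m_T} = sup_{0≤j≤T−1} E[(Σ_{i=j+1}^{min{j+m_T,T}} Z_{i,T})²]. -/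

import Mathlib

open Filter Set MeasureTheory ProbabilityTheory

/-- The σ-algebra generated by the random variables `X l`, `a ≤ l ≤ b`. -/
def sigmaGen {Ω : Type*} (X : ℕ → Ω → ℝ) (a b : ℕ) : MeasurableSpace Ω :=
  ⨆ l ∈ Set.Icc a b, MeasurableSpace.comap (X l) inferInstance

/-- The strong (α-)mixing coefficient at lag `j` of the finite sequence
`X 1, …, X T`. -/
noncomputable def alphaMix {Ω : Type*} [MeasurableSpace Ω] (μ : Measure Ω)
    (X : ℕ → Ω → ℝ) (T j : ℕ) : ℝ :=
  sSup {r : ℝ | ∃ k A B, 1 ≤ k ∧ k + j ≤ T ∧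
    MeasurableSet[sigmaGen X 1 k] B ∧ MeasurableSet[sigmaGen X (k + j) T] A ∧
    r = |(μ (A ∩ B)).toReal - (μ A).toReal * (μ B).toReal|}


lemma exp_num1 (u : ℝ) (hu : |u| ≤ 6/5) : Real.exp u ≤ 1 + u + 4/5 * u^2 := by
  obtain ⟨v, rfl⟩ : ∃ v, u = v + v := ⟨u/2, by ring⟩
  have hv : |v| ≤ 3/5 := by
    rw [abs_le] at hu ⊢; constructor <;> linarith [hu.1, hu.2]
  have h := Real.exp_bound (x := v) (by linarith) (n := 4) (by norm_num)
  simp only [Finset.sum_range_succ, Finset.sum_range_zero, Nat.factorial] at h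
  norm_num at h
  have h2 := (abs_le.1 h).2
  have e4 : |v|^4 = v^4 := by rw [← abs_pow]; exact abs_of_nonneg (by positivity)
  rw [e4] at h2
  rw [abs_le] at hv
  rw [Real.exp_add]
  have hp := Real.exp_pos v
  set E := Real.exp v
  have h3 : E ≤ 1 + v + v^2/2 + v^3/6 + v^4*(5/96) := by linarith
  have h4 : E * E ≤ (1 + v + v^2/2 + v^3/6 + v^4*(5/96)) * (1 + v + v^2/2 + v^3/6 + v^4*(5/96)) :=
    mul_self_le_mul_self hp.le h3
  refine h4.trans ?_
  have : 0 ≤ v^2 * (6/5 - 4/3*v - 11/16*v^2 - 13/48*v^3 - (1/36+5/96)*v^4 - 5/288*v^5 - 25/9216*v^6) := by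
    apply mul_nonneg (sq_nonneg _)
    have a1 : |v| ≤ 3/5 := abs_le.2 hv
    have b1 := fun n : ℕ => pow_le_pow_left₀ (abs_nonneg v) a1 n
    have b2 := fun n : ℕ => (le_abs_self (v^n)).trans ((abs_pow v n).le.trans (b1 n))
    have := b2 2; have := b2 3; have := b2 4; have := b2 5; have := b2 6
    norm_num at *
    linarith
  nlinarith [this]

lemma sinh_num (x : ℝ) (h0 : 0 ≤ x) (hx : x ≤ 6/5) :
    Real.exp x - Real.exp (-x) ≤ 66/25 * x := by
  obtain ⟨v, rfl⟩ : ∃ v, x = v + v := ⟨x/2, by ring⟩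
  have hv : v ≤ 3/5 := by linarith
  have hv0 : 0 ≤ v := by linarith
  have h := Real.exp_bound (x := v) (by rw [abs_of_nonneg hv0]; linarith) (n := 4) (by norm_num)
  have h' := Real.exp_bound (x := -v) (by rw [abs_neg, abs_of_nonneg hv0]; linarith) (n := 4) (by norm_num)
  simp only [Finset.sum_range_succ, Finset.sum_range_zero, Nat.factorial, abs_neg, abs_of_nonneg hv0] at h h'
  norm_num at h h'
  have h2 := (abs_le.1 h).2
  have h3 := (abs_le.1 h').1
  rw [neg_add, Real.exp_add, Real.exp_add]
  have hp := Real.exp_pos v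
  have hp' := Real.exp_pos (-v)
  have h1 : Real.exp v * Real.exp (-v) = 1 := by rw [← Real.exp_add]; simp
  set E := Real.exp v
  set E' := Real.exp (-v)
  have h5 : E' ≤ 1 - v + v^2/2 - v^3/6 + v^4*(5/96) := by
    have := (abs_le.1 h').2
    nlinarith
  have d1 : E - E' ≤ 2*v + v^3/3 + v^4*(5/48) := by nlinarith
  have d2 : E + E' ≤ 2 + v^2 + v^4*(5/48) := by nlinarith
  have d3 : E * E - E' * E' ≤ (2*v + v^3/3 + v^4*(5/48)) * (2 + v^2 + v^4*(5/48)) := by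
    have : E * E - E' * E' = (E - E') * (E + E') := by ring
    rw [this]
    exact mul_le_mul d1 d2 (by positivity) (by positivity)
  refine d3.trans ?_
  have : (2 + v^2/3 + v^3*(5/48)) * (2 + v^2 + v^4*(5/48)) ≤ 132/25 := by
    have b1 := fun n : ℕ => pow_le_pow_left₀ hv0 hv n
    calc _ ≤ (2 + (3/5)^2/3 + (3/5)^3*(5/48)) * (2 + (3/5)^2 + (3/5)^4*(5/48) : ℝ) := by
          have := b1 2; have := b1 3; have := b1 4; gcongr
      _ ≤ _ := by norm_num
  nlinarith

lemma final_num (y : ℝ) (hy : 0 ≤ y) :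
    -(67/200) * (6/(30*y+5)) + 4/5 * (6/(30*y+5))^2 * y ≤ -(1/(128/3*y + 8/3)) := by
  have h1 : 0 < 30*y+5 := by linarith
  have h2 : 0 < 128/3*y+8/3 := by linarith
  rw [← sub_nonneg]
  have : -(1/(128/3*y + 8/3)) - (-(67/200) * (6/(30*y+5)) + 4/5 * (6/(30*y+5))^2 * y)
    = (((67/200)*6*(30*y+5) - 4/5*36*y) * (128/3*y+8/3) - (30*y+5)^2) / ((30*y+5)^2*(128/3*y+8/3)) := by
    field_simp; ring
  rw [this]
  apply div_nonneg _ (by positivity)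
  nlinarith [sq_nonneg y]
section aux

set_option linter.unusedSectionVars false

variable {Ω : Type*} {m0 : MeasurableSpace Ω} {μ : Measure Ω} [IsProbabilityMeasure μ]

lemma int_of_bdd {f : Ω → ℝ} (hf : AEStronglyMeasurable f μ) (C : ℝ) (h : ∀ᵐ ω ∂μ, |f ω| ≤ C) :
    Integrable f μ := Integrable.of_bound hf C (by simpa [Real.norm_eq_abs] using h)

/-- positive part of condexp deviation = covariance with indicator -/
lemma pos_part_cov {F : MeasurableSpace Ω} (hF : F ≤ m0) {W : Ω → ℝ} (hW : Integrable W μ) (c : ℝ) :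
    ∃ B, MeasurableSet[F] B ∧ ∫ ω, max (μ[W|F] ω - c) 0 ∂μ = (∫ ω in B, W ω ∂μ) - c * μ.real B := by
  have hm : StronglyMeasurable[F] (μ[W|F]) := stronglyMeasurable_condExp
  have hB : MeasurableSet[F] {ω | c < μ[W|F] ω} := 
    @measurableSet_lt _ _ _ _ _ F _ _ _ _ _ measurable_const hm.measurable
  refine ⟨_, hB, ?_⟩
  rw [← setIntegral_condExp hF hW hB]
  have h1 : ∀ ω, max (μ[W|F] ω - c) 0 = ({ω | c < μ[W|F] ω}).indicator (fun ω => μ[W|F] ω - c) ω := by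
    intro ω
    by_cases h : c < μ[W|F] ω
    · rw [indicator_of_mem (by exact h), max_eq_left (by linarith)]
    · rw [indicator_of_notMem (by exact h), max_eq_right (by linarith)]
  simp_rw [h1]
  rw [integral_indicator (hF _ hB), integral_sub integrable_condExp.integrableOn (integrable_const c).integrableOn]
  simp [mul_comm]

lemma condExp_dev {F G : MeasurableSpace Ω} (hF : F ≤ m0) (hG : G ≤ m0) {W : Ω → ℝ} (hW : StronglyMeasurable[G] W)
    (lo hi α : ℝ) (hlo : ∀ᵐ ω ∂μ, lo ≤ W ω) (hhi : ∀ᵐ ω ∂μ, W ω ≤ hi)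
    (hα : ∀ A B, MeasurableSet[G] A → MeasurableSet[F] B → μ.real (A ∩ B) - μ.real A * μ.real B ≤ α) :
    ∫ ω, max (μ[W|F] ω - ∫ ω, W ω ∂μ) 0 ∂μ ≤ α * (hi - lo) := by
  have hWm := (hW.mono hG).aestronglyMeasurable (μ := μ)
  have hWi : Integrable W μ := int_of_bdd hWm (max |lo| |hi|) (by
    filter_upwards [hlo, hhi] with ω h1 h2
    exact abs_le_max_abs_abs h1 h2)
  obtain ⟨B, hB, hBe⟩ := pos_part_cov hF hWi (∫ ω, W ω ∂μ)
  rw [hBe]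
  set I : Ω → ℝ := B.indicator (fun _ => (1:ℝ)) with hI
  have hIi : Integrable I μ := (integrable_const (1:ℝ)).indicator (hF _ hB)
  obtain ⟨A, hA, hAe⟩ := pos_part_cov hG hIi (μ.real B)
  have hAe2 : ∫ ω in A, I ω ∂μ = μ.real (A ∩ B) := by
    rw [hI, setIntegral_indicator (hF _ hB)]; simp
  have hdev : ∫ ω, max (μ[I|G] ω - μ.real B) 0 ∂μ ≤ α := by
    rw [hAe, hAe2, mul_comm]; exact hα A B hA hB
  have hlohi : lo ≤ hi := by
    obtain ⟨ω, h1, h2⟩ := (hlo.and hhi).exists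
    exact h1.trans h2
  have hIint : ∫ ω, I ω ∂μ = μ.real B := by rw [hI, integral_indicator (hF _ hB)]; simp
  have hcb : ∀ᵐ ω ∂μ, |W ω - lo| ≤ hi - lo := by
    filter_upwards [hlo, hhi] with ω h1 h2
    rw [abs_of_nonneg (by linarith)]; linarith
  have hWlo : StronglyMeasurable[G] (fun ω => W ω - lo) := hW.sub (@stronglyMeasurable_const _ _ G _ _)
  have hWI : Integrable ((fun ω => W ω - lo) * I) μ := by
    exact hIi.bdd_mul (hWlo.mono hG).aestronglyMeasurable (c := hi - lo) (by simpa [Real.norm_eq_abs] using hcb)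
  have e1 : ∫ ω, (W ω - lo) * μ[I|G] ω ∂μ = ∫ ω, (W ω - lo) * I ω ∂μ := by
    have := condExp_mul_of_stronglyMeasurable_left hWlo hWI hIi
    have h2 := integral_congr_ae this
    rw [integral_condExp hG] at h2
    exact h2.symm
  have e2 : ∫ ω, (W ω - lo) * I ω ∂μ = ∫ ω in B, W ω ∂μ - lo * μ.real B := by
    have : ∀ ω, (W ω - lo) * I ω = B.indicator (fun ω => W ω - lo) ω := by
      intro ω; by_cases h : ω ∈ B <;> simp [hI, h]
    simp_rw [this]
    rw [integral_indicator (hF _ hB), integral_sub hWi.integrableOn (integrable_const lo).integrableOn]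
    simp [mul_comm]
  have hPi : Integrable (fun ω => (W ω - lo) * μ[I|G] ω) μ :=
    integrable_condExp.bdd_mul (hWlo.mono hG).aestronglyMeasurable (c := hi - lo) (by simpa [Real.norm_eq_abs] using hcb)
  have hmaxi : Integrable (fun ω => max (μ[I|G] ω - μ.real B) 0) μ :=
    (integrable_condExp.sub (integrable_const _)).pos_part
  have e3 : ∫ ω, (W ω - lo) * (μ[I|G] ω - μ.real B) ∂μ = (∫ ω in B, W ω ∂μ) - (∫ ω, W ω ∂μ) * μ.real B := by
    have : ∀ ω, (W ω - lo) * (μ[I|G] ω - μ.real B) = (W ω - lo) * μ[I|G] ω - (W ω - lo) * μ.real B := by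
      intro ω; ring
    simp_rw [this]
    have hq : Integrable (fun ω => (W ω - lo) * μ.real B) μ := (hWi.sub (integrable_const lo)).mul_const _
    rw [integral_sub hPi hq, e1, e2, integral_mul_const,
      integral_sub hWi (integrable_const lo)]
    simp; ring
  rw [← e3]
  calc _ ≤ ∫ ω, max (μ[I|G] ω - μ.real B) 0 * (hi - lo) ∂μ := by
        apply integral_mono_ae
        · have := hPi.sub ((hWi.sub (integrable_const lo)).mul_const (μ.real B))
          refine this.congr (ae_of_all _ fun ω => ?_)
          simp; ring
        · exact hmaxi.mul_const _
        · filter_upwards [hlo, hhi] with ω h1 h2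
          have := le_max_left (μ[I|G] ω - μ.real B) 0
          have := le_max_right (μ[I|G] ω - μ.real B) 0
          calc _ ≤ (W ω - lo) * max (μ[I|G] ω - μ.real B) 0 := 
                mul_le_mul_of_nonneg_left (le_max_left _ _) (by linarith)
            _ ≤ _ := by rw [mul_comm]; exact mul_le_mul_of_nonneg_left (by linarith) (le_max_right _ _)
    _ ≤ _ := by
        rw [integral_mul_const]
        exact mul_le_mul_of_nonneg_right hdev (by linarith)

noncomputable def devP {Ω : Type*} {m0 : MeasurableSpace Ω} (μ : Measure Ω) (F : MeasurableSpace Ω) (W : Ω → ℝ) : Ω → ℝ :=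
  fun ω => max (μ[W|F] ω - ∫ ω, W ω ∂μ) 0

lemma devP_nonneg (F : MeasurableSpace Ω) (W : Ω → ℝ) (ω : Ω) : 0 ≤ devP μ F W ω := le_max_right _ _

lemma devP_meas (F : MeasurableSpace Ω) (W : Ω → ℝ) : Measurable[F] (devP μ F W) := by
  have hm : Measurable[F] (μ[W|F]) := stronglyMeasurable_condExp.measurable
  exact (hm.sub_const _).max measurable_const

lemma devP_int (F : MeasurableSpace Ω) (W : Ω → ℝ) : Integrable (devP μ F W) μ :=
  (integrable_condExp.sub (integrable_const _)).pos_part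

lemma expX_int {X : Ω → ℝ} (hX : Measurable X) {M : ℝ} (hb : ∀ᵐ ω ∂μ, |X ω| ≤ M) (t : ℝ) :
    Integrable (fun ω => Real.exp (t * X ω)) μ := by
  refine int_of_bdd (by fun_prop) (Real.exp (|t| * M)) ?_
  filter_upwards [hb] with ω h
  rw [Real.abs_exp]
  apply Real.exp_le_exp.2
  calc _ ≤ |t * X ω| := le_abs_self _
    _ = |t| * |X ω| := abs_mul _ _
    _ ≤ _ := by gcongr

lemma mgf_ge_one {X : Ω → ℝ} (hX : Measurable X) {M : ℝ} (hb : ∀ᵐ ω ∂μ, |X ω| ≤ M) (t : ℝ)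
    (hmean : ∫ ω, X ω ∂μ = 0) : 1 ≤ ∫ ω, Real.exp (t * X ω) ∂μ := by
  have hXi : Integrable X μ := int_of_bdd hX.aestronglyMeasurable M hb
  have : ∫ ω, (1 + t * X ω) ∂μ = 1 := by
    rw [integral_add (integrable_const _) (hXi.const_mul t), integral_const_mul, hmean]; simp
  rw [← this]
  apply integral_mono ((integrable_const _).add (hXi.const_mul t)) (expX_int hX hb t)
  intro ω
  have := Real.add_one_le_exp (t * X ω)
  simp only [Pi.add_apply]; linarith

lemma mgf_le {X : Ω → ℝ} (hX : Measurable X) {M : ℝ} (hb : ∀ᵐ ω ∂μ, |X ω| ≤ M) (t : ℝ)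
    (htM : |t| * M ≤ 6/5) (hmean : ∫ ω, X ω ∂μ = 0) :
    ∫ ω, Real.exp (t * X ω) ∂μ ≤ Real.exp (4/5 * t^2 * ∫ ω, X ω ^ 2 ∂μ) := by
  have hXi : Integrable X μ := int_of_bdd hX.aestronglyMeasurable M hb
  have hX2 : Integrable (fun ω => X ω ^ 2) μ := by
    refine int_of_bdd (by fun_prop) (M^2) ?_
    filter_upwards [hb] with ω h
    rw [abs_pow]; gcongr
  have h1 : Integrable (fun ω => 1 + t * X ω) μ := (integrable_const _).add (hXi.const_mul t)
  have h2 : Integrable (fun ω => 4/5 * t^2 * X ω ^ 2) μ := hX2.const_mul _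
  have : ∫ ω, (1 + t * X ω + 4/5 * t^2 * X ω ^2) ∂μ = 1 + 4/5 * t^2 * ∫ ω, X ω ^2 ∂μ := by
    rw [integral_add h1 h2, integral_add (integrable_const _) (hXi.const_mul t), integral_const_mul, hmean, integral_const_mul]; simp
  calc _ ≤ ∫ ω, (1 + t * X ω + 4/5 * t^2 * X ω ^2) ∂μ := by
        apply integral_mono_ae (expX_int hX hb t) (h1.add h2)
        filter_upwards [hb] with ω h
        have := exp_num1 (t * X ω) (by
          rw [abs_mul]; exact (mul_le_mul_of_nonneg_left h (abs_nonneg t)).trans htM)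
        simp only [Pi.add_apply]
        linarith [this]
    _ ≤ _ := by
        rw [this, add_comm]; exact Real.add_one_le_exp _

lemma exp_prod (F : ℕ → MeasurableSpace Ω) (hF : ∀ k, F k ≤ m0) (hmono : Monotone F)
    (p : ℕ → Prop) [DecidablePred p] (X : ℕ → Ω → ℝ) (hXm : ∀ k, Measurable (X k))
    (hX : ∀ k n, p k → p n → k < n → Measurable[F n] (X k)) (M : ℝ)
    (hb : ∀ k, ∀ᵐ ω ∂μ, |X k ω| ≤ M) (hmean : ∀ k, ∫ ω, X k ω ∂μ = 0) (t : ℝ) (n : ℕ) :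
    Integrable (fun ω => Real.exp (∑ k ∈ Finset.range n with p k,
      (t * X k ω - devP μ (F k) (fun ω => Real.exp (t * X k ω)) ω))) μ ∧
    ∫ ω, Real.exp (∑ k ∈ Finset.range n with p k,
      (t * X k ω - devP μ (F k) (fun ω => Real.exp (t * X k ω)) ω)) ∂μ ≤
      ∏ k ∈ Finset.range n with p k, ∫ ω, Real.exp (t * X k ω) ∂μ := by
  set D : ℕ → Ω → ℝ := fun k => devP μ (F k) (fun ω => Real.exp (t * X k ω)) with hD
  have hDm : ∀ k, Measurable[F k] (D k) := fun k => devP_meas _ _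
  have hDm0 : ∀ k, Measurable (D k) := fun k => (hDm k).mono (hF k) le_rfl
  have hD0 : ∀ k ω, 0 ≤ D k ω := fun k ω => devP_nonneg _ _ _
  set Y : ℕ → Ω → ℝ := fun n ω => Real.exp (∑ k ∈ Finset.range n with p k, (t * X k ω - D k ω)) with hY
  have hYm : ∀ n, Measurable (Y n) := by
    intro n
    apply Real.measurable_exp.comp
    apply Finset.measurable_sum
    intro k _
    exact ((hXm k).const_mul t).sub (hDm0 k)
  have hYmF : ∀ n, p n → Measurable[F n] (Y n) := by
    intro n hn
    apply Real.measurable_exp.comp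
    apply Finset.measurable_sum
    intro k hk
    simp only [Finset.mem_filter, Finset.mem_range] at hk
    exact ((hX k n hk.2 hn hk.1).const_mul t).sub ((hDm k).mono (hmono hk.1.le) le_rfl)
  have hYb : ∀ n, ∃ C, ∀ᵐ ω ∂μ, |Y n ω| ≤ C := by
    intro n
    refine ⟨Real.exp (∑ k ∈ Finset.range n with p k, |t| * M), ?_⟩
    filter_upwards [ae_all_iff.2 hb] with ω h
    simp only [hY, Real.abs_exp]
    apply Real.exp_le_exp.2
    apply Finset.sum_le_sum
    intro k _
    have h1 := hD0 k ω
    have h2 : t * X k ω ≤ |t| * M :=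
      calc _ ≤ |t * X k ω| := le_abs_self _
        _ = |t| * |X k ω| := abs_mul _ _
        _ ≤ _ := mul_le_mul_of_nonneg_left (h k) (abs_nonneg t)
    linarith
  have hYi : ∀ n, Integrable (Y n) μ := by
    intro n
    obtain ⟨C, hC⟩ := hYb n
    exact int_of_bdd (hYm n).aestronglyMeasurable C hC
  refine ⟨hYi n, ?_⟩
  change ∫ ω, Y n ω ∂μ ≤ _
  induction n with
  | zero => simp [hY]
  | succ n ih =>
    by_cases hp : p n
    · have hpr : ∏ k ∈ Finset.range (n+1) with p k, ∫ ω, Real.exp (t * X k ω) ∂μ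
          = (∏ k ∈ Finset.range n with p k, ∫ ω, Real.exp (t * X k ω) ∂μ) * ∫ ω, Real.exp (t * X n ω) ∂μ := by
        rw [Finset.range_add_one, Finset.filter_insert, if_pos hp, Finset.prod_insert (by simp), mul_comm]
      rw [hpr]
      set c := ∫ ω, Real.exp (t * X n ω) ∂μ with hc
      have hc1 : 1 ≤ c := mgf_ge_one (hXm n) (hb n) t (hmean n)
      set W : Ω → ℝ := fun ω => Real.exp (t * X n ω) with hW
      have hWi : Integrable W μ := expX_int (hXm n) (hb n) t
      set H : Ω → ℝ := fun ω => Y n ω * Real.exp (- D n ω) with hH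
      have hHm : Measurable[F n] H := (hYmF n hp).mul (Real.measurable_exp.comp (hDm n).neg)
      have hHs : StronglyMeasurable[F n] H := hHm.stronglyMeasurable
      have hYH : ∀ ω, Y (n+1) ω = H ω * W ω := by
        intro ω
        simp only [hY, hH, hW]
        rw [Finset.range_add_one, Finset.filter_insert, if_pos hp, Finset.sum_insert (by simp), ← Real.exp_add, ← Real.exp_add]
        congr 1; ring
      obtain ⟨C, hC⟩ := hYb n
      have hHb : ∀ᵐ ω ∂μ, ‖H ω‖ ≤ C := by
        filter_upwards [hC] with ω h
        rw [Real.norm_eq_abs, hH, abs_mul, Real.abs_exp (- D n ω)]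
        have : Real.exp (- D n ω) ≤ 1 := Real.exp_le_one_iff.2 (by linarith [hD0 n ω])
        calc _ ≤ |Y n ω| * 1 := mul_le_mul_of_nonneg_left this (abs_nonneg _)
          _ ≤ C := by linarith
      have hHW : Integrable (H * W) μ := hWi.bdd_mul (hHs.mono (hF n)).aestronglyMeasurable hHb
      have hHP : Integrable (H * μ[W|F n]) μ :=
        integrable_condExp.bdd_mul (hHs.mono (hF n)).aestronglyMeasurable hHb
      have e1 : ∫ ω, H ω * W ω ∂μ = ∫ ω, H ω * μ[W|F n] ω ∂μ := by
        have := integral_congr_ae (condExp_mul_of_stronglyMeasurable_left hHs hHW hWi)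
        rw [integral_condExp (hF n)] at this
        exact this
      simp_rw [hYH]
      rw [e1]
      calc _ ≤ ∫ ω, Y n ω * c ∂μ := by
            apply integral_mono hHP ((hYi n).mul_const c)
            intro ω
            simp only [hH, Pi.mul_apply]
            rw [mul_assoc]
            apply mul_le_mul_of_nonneg_left _ (Real.exp_pos _).le
            have h1 : μ[W|F n] ω - c ≤ D n ω := le_max_left _ _
            have h2 : 1 + D n ω ≤ Real.exp (D n ω) := by linarith [Real.add_one_le_exp (D n ω)]
            have h3 : μ[W|F n] ω ≤ c * Real.exp (D n ω) := by nlinarith [hD0 n ω]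
            calc _ ≤ Real.exp (-D n ω) * (c * Real.exp (D n ω)) :=
                  mul_le_mul_of_nonneg_left h3 (Real.exp_pos _).le
              _ = c * (Real.exp (-D n ω) * Real.exp (D n ω)) := by ring
              _ = c := by rw [← Real.exp_add]; simp
        _ ≤ _ := by
            rw [integral_mul_const]
            exact mul_le_mul_of_nonneg_right ih (by linarith)
    · have : Finset.filter p (Finset.range (n+1)) = Finset.filter p (Finset.range n) := by
        rw [Finset.range_add_one, Finset.filter_insert, if_neg hp]
      simp only [hY, this] at ih ⊢
      exact ih

lemma parity_tail (F : ℕ → MeasurableSpace Ω) (hF : ∀ k, F k ≤ m0) (hmono : Monotone F)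
    (p : ℕ → Prop) [DecidablePred p] (X : ℕ → Ω → ℝ) (hXm : ∀ k, Measurable (X k))
    (hX : ∀ k n, p k → p n → k < n → Measurable[F n] (X k)) (M : ℝ)
    (hb : ∀ k, ∀ᵐ ω ∂μ, |X k ω| ≤ M) (hmean : ∀ k, ∫ ω, X k ω ∂μ = 0) (t : ℝ)
    (htM : |t| * M ≤ 6/5) (n : ℕ) (V : ℝ)
    (hV : ∑ k ∈ Finset.range n with p k, ∫ ω, X k ω ^ 2 ∂μ ≤ V) (θ : ℝ) :
    μ.real {ω | θ ≤ ∑ k ∈ Finset.range n with p k,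
      (t * X k ω - devP μ (F k) (fun ω => Real.exp (t * X k ω)) ω)} ≤ Real.exp (-θ + 4/5*t^2*V) := by
  obtain ⟨hi, hle⟩ := exp_prod F hF hmono p X hXm hX M hb hmean t n
  set S : Ω → ℝ := fun ω => ∑ k ∈ Finset.range n with p k,
      (t * X k ω - devP μ (F k) (fun ω => Real.exp (t * X k ω)) ω)
  have h1 := mul_meas_ge_le_integral_of_nonneg (ae_of_all μ fun ω => (Real.exp_pos (S ω)).le) hi (Real.exp θ)
  have h2 : {ω | Real.exp θ ≤ Real.exp (S ω)} = {ω | θ ≤ S ω} := by ext; simp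
  have h3 : ∫ ω, Real.exp (S ω) ∂μ ≤ Real.exp (4/5*t^2*V) := by
    refine hle.trans ?_
    calc _ ≤ ∏ k ∈ Finset.range n with p k, Real.exp (4/5 * t^2 * ∫ ω, X k ω ^ 2 ∂μ) := by
          apply Finset.prod_le_prod
          · intro k _; exact integral_nonneg fun ω => (Real.exp_pos _).le
          · intro k _; exact mgf_le (hXm k) (hb k) t htM (hmean k)
      _ ≤ _ := by
          rw [← Real.exp_sum, ← Finset.mul_sum]
          apply Real.exp_le_exp.2
          gcongr
  change Real.exp θ * μ.real {ω | Real.exp θ ≤ Real.exp (S ω)} ≤ _ at h1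
  rw [h2] at h1
  change μ.real {ω | θ ≤ S ω} ≤ _
  rw [Real.exp_add, Real.exp_neg, ← div_eq_inv_mul, le_div_iff₀ (Real.exp_pos _), mul_comm]
  exact h1.trans h3

lemma one_sided (F : ℕ → MeasurableSpace Ω) (hF : ∀ k, F k ≤ m0) (hmono : Monotone F)
    (U : ℕ → Ω → ℝ) (hUm : ∀ k, Measurable (U k))
    (hU : ∀ k n, k + 2 ≤ n → Measurable[F n] (U k)) (M : ℝ) (hM : 0 < M)
    (hb : ∀ k, ∀ᵐ ω ∂μ, |U k ω| ≤ M) (hmean : ∀ k, ∫ ω, U k ω ∂μ = 0)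
    (ε : ℝ) (hε : 4 * M < ε) (x : ℝ) (hx : 0 < x) (hx2 : x ≤ 6/5) (n : ℕ) (V : ℝ)
    (hV : ∀ r, ∑ k ∈ Finset.range n with k % 2 = r, ∫ ω, U k ω ^ 2 ∂μ ≤ V)
    (K : ℝ) (hK : 0 ≤ K)
    (hD : ∑ k ∈ Finset.range n, ∫ ω, devP μ (F k) (fun ω => Real.exp (x / M * U k ω)) ω ∂μ
      ≤ K * (Real.exp x - Real.exp (-x))) :
    μ.real {ω | ε < ∑ k ∈ Finset.range n, U k ω} ≤
      2 * Real.exp (ε / M * (-(67/200) * x) + 4/5 * x^2 * V / M^2) + 2 * K := by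
  set t := x / M with ht
  have ht0 : 0 < t := div_pos hx hM
  have htM : t * M = x := by rw [ht]; field_simp
  have htM' : |t| * M ≤ 6/5 := by rw [abs_of_pos ht0, htM]; exact hx2
  set D : ℕ → Ω → ℝ := fun k => devP μ (F k) (fun ω => Real.exp (t * U k ω)) with hDdef
  have hpar := fun r : ℕ => parity_tail F hF hmono (fun k => k % 2 = r) U hUm
    (fun k n hk hn hkn => hU k n (by omega)) M hb hmean t htM' n V (hV r) (t * (67/200) * ε)
  have hDi : ∀ k, Integrable (D k) μ := fun k => devP_int _ _
  have hRi : Integrable (fun ω => ∑ k ∈ Finset.range n, D k ω) μ := integrable_finsetSum _ fun k _ => hDi k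
  have hmk := mul_meas_ge_le_integral_of_nonneg
    (ae_of_all μ fun ω => Finset.sum_nonneg fun k (_ : k ∈ Finset.range n) => devP_nonneg (μ := μ) (F k) (fun ω => Real.exp (t * U k ω)) ω) hRi
    (t * (33/100) * ε)
  rw [integral_finsetSum _ fun k _ => hDi k] at hmk
  have hεp : 0 < ε := by linarith
  have hR : μ.real {ω | t * (33/100) * ε ≤ ∑ k ∈ Finset.range n, D k ω} ≤ 2 * K := by
    have h1 := hmk.trans hD
    have h2 := mul_le_mul_of_nonneg_left (sinh_num x hx.le hx2) hK
    have h3 : t * (33/100) * ε * μ.real {ω | t * (33/100) * ε ≤ ∑ k ∈ Finset.range n, D k ω} ≤ K * (66/25*x) := h1.trans h2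
    have h4 : K * (66/25 * x) ≤ t * (33/100) * ε * (2 * K) := by
      rw [← htM]
      have : t * M ≤ t * (ε / 4) := by gcongr; linarith
      nlinarith
    exact le_of_mul_le_mul_left (h3.trans h4) (by positivity)
  have hsub : {ω | ε < ∑ k ∈ Finset.range n, U k ω} ⊆
      ({ω | t * (67/200) * ε ≤ ∑ k ∈ Finset.range n with k % 2 = 0, (t * U k ω - D k ω)} ∪
      {ω | t * (67/200) * ε ≤ ∑ k ∈ Finset.range n with k % 2 = 1, (t * U k ω - D k ω)}) ∪
      {ω | t * (33/100) * ε ≤ ∑ k ∈ Finset.range n, D k ω} := by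
    intro ω hω
    by_contra hcon
    simp only [mem_union, mem_ofPred_eq, not_or, not_le] at hcon hω
    obtain ⟨⟨h1, h2⟩, h3⟩ := hcon
    have hs : ∑ k ∈ Finset.range n, (t * U k ω - D k ω) =
      ∑ k ∈ Finset.range n with k % 2 = 0, (t * U k ω - D k ω) +
      ∑ k ∈ Finset.range n with k % 2 = 1, (t * U k ω - D k ω) := by
      rw [← Finset.sum_filter_add_sum_filter_not _ (fun k => k % 2 = 0)]
      congr 2
      ext k; simp
    rw [Finset.sum_sub_distrib, ← Finset.mul_sum] at hs
    have := mul_lt_mul_of_pos_left hω ht0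
    nlinarith
  have e : -(t * (67/200) * ε) + 4/5*t^2*V = ε / M * (-(67/200) * x) + 4/5 * x^2 * V / M^2 := by
    rw [ht]; field_simp
  have h0 := hpar 0
  have h1 := hpar 1
  rw [e] at h0 h1
  have := measureReal_mono hsub (measure_ne_top μ _)
  have u1 := measureReal_union_le (μ := μ) ({ω | t * (67/200) * ε ≤ ∑ k ∈ Finset.range n with k % 2 = 0, (t * U k ω - D k ω)} ∪
      {ω | t * (67/200) * ε ≤ ∑ k ∈ Finset.range n with k % 2 = 1, (t * U k ω - D k ω)}) {ω | t * (33/100) * ε ≤ ∑ k ∈ Finset.range n, D k ω}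
  have u2 := measureReal_union_le (μ := μ) {ω | t * (67/200) * ε ≤ ∑ k ∈ Finset.range n with k % 2 = 0, (t * U k ω - D k ω)}
      {ω | t * (67/200) * ε ≤ ∑ k ∈ Finset.range n with k % 2 = 1, (t * U k ω - D k ω)}
  linarith

end aux

lemma sigmaGen_mono {Ω : Type*} (X : ℕ → Ω → ℝ) {a b a' b' : ℕ} (ha : a' ≤ a) (hb : b ≤ b') :
    sigmaGen X a b ≤ sigmaGen X a' b' := by
  unfold sigmaGen
  exact biSup_mono fun i hi => ⟨ha.trans hi.1, hi.2.trans hb⟩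

lemma sigmaGen_le {Ω : Type*} {m0 : MeasurableSpace Ω} (X : ℕ → Ω → ℝ) (hX : ∀ i, Measurable (X i)) (a b : ℕ) :
    sigmaGen X a b ≤ m0 := by
  unfold sigmaGen
  exact iSup₂_le fun i _ => (hX i).comap_le

lemma sigmaGen_meas {Ω : Type*} (X : ℕ → Ω → ℝ) {a b i : ℕ} (ha : a ≤ i) (hb : i ≤ b) :
    Measurable[sigmaGen X a b] (X i) := by
  apply Measurable.of_comap_le
  unfold sigmaGen
  exact le_iSup₂_of_le i ⟨ha, hb⟩ le_rfl

lemma sigmaGen_bot {Ω : Type*} (X : ℕ → Ω → ℝ) : sigmaGen X 1 0 = ⊥ := by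
  unfold sigmaGen; simp

lemma alphaMix_nonneg {Ω : Type*} [MeasurableSpace Ω] (μ : Measure Ω)
    (X : ℕ → Ω → ℝ) (T j : ℕ) : 0 ≤ alphaMix μ X T j := by
  apply Real.sSup_nonneg
  rintro r ⟨k, A, B, -, -, -, -, rfl⟩
  exact abs_nonneg _

lemma alphaMix_le {Ω : Type*} [MeasurableSpace Ω] (μ : Measure Ω) [IsProbabilityMeasure μ]
    (X : ℕ → Ω → ℝ) (T j k : ℕ) (h1 : 1 ≤ k) (h2 : k + j ≤ T) (A B : Set Ω)
    (hA : MeasurableSet[sigmaGen X (k + j) T] A) (hB : MeasurableSet[sigmaGen X 1 k] B) :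
    μ.real (A ∩ B) - μ.real A * μ.real B ≤ alphaMix μ X T j := by
  refine (le_abs_self _).trans (le_csSup ⟨1, ?_⟩ ⟨k, A, B, h1, h2, hB, hA, rfl⟩)
  rintro r ⟨k, A, B, -, -, -, -, rfl⟩
  change |μ.real (A ∩ B) - μ.real A * μ.real B| ≤ 1
  have := measureReal_nonneg (μ := μ) (s := A ∩ B)
  have := measureReal_nonneg (μ := μ) (s := A)
  have := measureReal_nonneg (μ := μ) (s := B)
  have := measureReal_le_one (μ := μ) (s := A ∩ B)
  have := measureReal_le_one (μ := μ) (s := A)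
  have := measureReal_le_one (μ := μ) (s := B)
  rw [abs_le]; constructor <;> nlinarith

lemma blocks_sum (f : ℕ → ℝ) (T m n : ℕ) :
    ∑ k ∈ Finset.range n, ∑ i ∈ Finset.Icc (k * m + 1) (min (k * m + m) T), f i =
      ∑ i ∈ Finset.Icc 1 (min (n * m) T), f i := by
  induction n with
  | zero => simp
  | succ n ih =>
    rw [Finset.sum_range_succ, ih, ← Finset.sum_union]
    · apply Finset.sum_congr _ fun _ _ => rfl
      ext i
      simp only [Finset.mem_union, Finset.mem_Icc, add_mul, one_mul]
      omega
    · rw [Finset.disjoint_left]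
      intro i
      simp only [Finset.mem_Icc]
      omega

lemma parity_card (n r : ℕ) : (Finset.filter (fun k => k % 2 = r) (Finset.range n)).card ≤ (n + 1) / 2 := by
  rw [← Finset.card_range ((n+1)/2)]
  apply Finset.card_le_card_of_injOn (fun k => k / 2)
  · intro k hk
    simp at hk ⊢
    omega
  · intro k hk l hl h
    simp at hk hl h
    omega

/-- Liebscher–Rio exponential inequality for bounded, centered, strongly mixing
triangular arrays. -/
theorem liebscher_rio_inequality
    {Ω : Type*} [MeasurableSpace Ω] (μ : Measure Ω) [IsProbabilityMeasure μ]
    (T : ℕ) (hT : 1 ≤ T) (Z : ℕ → Ω → ℝ) (b : ℝ)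
    (hmeas : ∀ i, Measurable (Z i))
    (hmean : ∀ i, 1 ≤ i → i ≤ T → (∫ ω, Z i ω ∂μ) = 0)
    (hbd : ∀ i, 1 ≤ i → i ≤ T → ∀ᵐ ω ∂μ, |Z i ω| ≤ b)
    (ε : ℝ) (hε : 0 < ε)
    (m : ℕ) (hm1 : 1 ≤ m) (hmT : m ≤ T)
    (hbm : 4 * b * m < ε)
    (sigsq : ℝ)
    (hσ : sigsq = sSup {r : ℝ | ∃ j : ℕ, j ≤ T - 1 ∧
      r = ∫ ω, (∑ i ∈ Finset.Icc (j + 1) (min (j + m) T), Z i ω) ^ 2 ∂μ}) :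
    (μ {ω | ε < |∑ i ∈ Finset.Icc 1 T, Z i ω|}).toReal ≤
      4 * Real.exp (-ε ^ 2 / (64 * sigsq * T / m + 8 / 3 * ε * b * m)) +
        4 * alphaMix μ Z T m * T / m := by
  have hα0 := alphaMix_nonneg μ Z T m
  have hbd' : ∀ᵐ ω ∂μ, ∀ i, 1 ≤ i → i ≤ T → |Z i ω| ≤ b := by
    rw [ae_all_iff]; intro i
    by_cases h : 1 ≤ i ∧ i ≤ T
    · filter_upwards [hbd i h.1 h.2] with ω hω _ _ using hω
    · exact ae_of_all _ fun ω h1 h2 => absurd ⟨h1, h2⟩ h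
  rcases le_or_gt b 0 with hb0 | hb0
  · have : μ {ω | ε < |∑ i ∈ Finset.Icc 1 T, Z i ω|} = 0 := by
      rw [← ae_eq_empty, eventuallyEq_empty]
      filter_upwards [hbd'] with ω hω h
      have : ∑ i ∈ Finset.Icc 1 T, Z i ω = 0 := by
        apply Finset.sum_eq_zero
        intro i hi
        rw [Finset.mem_Icc] at hi
        exact abs_eq_zero.1 (le_antisymm ((hω i hi.1 hi.2).trans hb0) (abs_nonneg _))
      change ε < |∑ i ∈ Finset.Icc 1 T, Z i ω| at h
      rw [this, abs_zero] at h
      linarith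
    rw [this]
    simp only [ENNReal.toReal_zero]
    positivity
  have hm0 : (0:ℝ) < m := by exact_mod_cast hm1
  have hT0 : (0:ℝ) < T := by exact_mod_cast hT
  obtain ⟨M, hM⟩ : ∃ M, M = b * m := ⟨_, rfl⟩
  have hM0 : 0 < M := by rw [hM]; positivity
  have hσn : 0 ≤ sigsq := by
    rw [hσ]; apply Real.sSup_nonneg
    rintro r ⟨j, -, rfl⟩
    exact integral_nonneg fun ω => sq_nonneg _
  have hσle : ∀ j, j ≤ T - 1 → ∫ ω, (∑ i ∈ Finset.Icc (j + 1) (min (j + m) T), Z i ω) ^ 2 ∂μ ≤ sigsq := by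
    intro j hj
    rw [hσ]
    refine le_csSup (Set.Finite.bddAbove ?_) ⟨j, hj, rfl⟩
    refine ((Set.finite_Iic (T-1)).image fun j => ∫ ω, (∑ i ∈ Finset.Icc (j + 1) (min (j + m) T), Z i ω) ^ 2 ∂μ).subset ?_
    rintro r ⟨j, hj, rfl⟩
    exact ⟨j, hj, rfl⟩
  set U : ℕ → Ω → ℝ := fun k ω => ∑ i ∈ Finset.Icc (k * m + 1) (min (k * m + m) T), Z i ω with hU
  have hUm : ∀ k, Measurable (U k) := fun k => Finset.measurable_sum _ fun i _ => hmeas i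
  have hUb : ∀ k, ∀ᵐ ω ∂μ, |U k ω| ≤ M := by
    intro k
    filter_upwards [hbd'] with ω hω
    calc |U k ω| ≤ ∑ i ∈ Finset.Icc (k * m + 1) (min (k * m + m) T), |Z i ω| := Finset.abs_sum_le_sum_abs _ _
      _ ≤ ∑ i ∈ Finset.Icc (k * m + 1) (min (k * m + m) T), b := by
          apply Finset.sum_le_sum
          intro i hi
          rw [Finset.mem_Icc] at hi
          exact hω i (by omega) (by omega)
      _ ≤ M := by
          rw [Finset.sum_const, nsmul_eq_mul, hM, mul_comm]
          have : (Finset.Icc (k * m + 1) (min (k * m + m) T)).card ≤ m := by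
            rw [Nat.card_Icc]; omega
          have : ((Finset.Icc (k * m + 1) (min (k * m + m) T)).card : ℝ) ≤ m := by exact_mod_cast this
          gcongr
  have hUmean : ∀ k, ∫ ω, U k ω ∂μ = 0 := by
    intro k
    simp only [hU]
    rw [integral_finsetSum]
    · apply Finset.sum_eq_zero
      intro i hi
      rw [Finset.mem_Icc] at hi
      exact hmean i (by omega) (by omega)
    · intro i hi
      rw [Finset.mem_Icc] at hi
      exact int_of_bdd (hmeas i).aestronglyMeasurable b (hbd i (by omega) (by omega))
  have hUS : ∀ k a c, a ≤ k * m + 1 → min (k * m + m) T ≤ c → Measurable[sigmaGen Z a c] (U k) := by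
    intro k a c h1 h2
    apply Finset.measurable_sum
    intro i hi
    rw [Finset.mem_Icc] at hi
    exact sigmaGen_meas Z (by omega) (by omega)
  set F : ℕ → MeasurableSpace Ω := fun k => sigmaGen Z 1 ((k - 1) * m) with hF
  have hFle : ∀ k, F k ≤ _ := fun k => sigmaGen_le Z hmeas _ _
  have hFmono : Monotone F := fun k l hkl =>
    sigmaGen_mono Z le_rfl (Nat.mul_le_mul_right m (Nat.sub_le_sub_right hkl 1))
  have hUF : ∀ k n, k + 2 ≤ n → Measurable[F n] (U k) := by
    intro k n hkn
    apply hUS k 1 _ (by omega)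
    have : (k + 1) * m ≤ (n - 1) * m := Nat.mul_le_mul_right m (by omega)
    rw [add_mul, one_mul] at this
    omega
  have hq1 : 1 ≤ T / m := Nat.div_pos hmT (by omega)
  have hqT : ((T / m : ℕ) : ℝ) ≤ T / m := Nat.cast_div_le
  have hV : ∀ r, ∑ k ∈ Finset.range (T / m + 1) with k % 2 = r, ∫ ω, U k ω ^ 2 ∂μ ≤ 3/2 * sigsq * T / m := by
    intro r
    calc _ ≤ ∑ k ∈ Finset.range (T / m + 1) with k % 2 = r, sigsq := by
          apply Finset.sum_le_sum
          intro k hk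
          by_cases h : k * m ≤ T - 1
          · exact hσle (k * m) h
          · have : Finset.Icc (k * m + 1) (min (k * m + m) T) = ∅ := by
              apply Finset.Icc_eq_empty; omega
            simp only [hU, this]
            simpa using hσn
      _ ≤ 3/2 * (T / m : ℕ) * sigsq := by
          rw [Finset.sum_const, nsmul_eq_mul]
          gcongr
          have h1 := parity_card (T / m + 1) r
          have h2 : 2 * (Finset.filter (fun k => k % 2 = r) (Finset.range (T / m + 1))).card ≤ 3 * (T / m) := by omega
          have h3 : (2:ℝ) * (Finset.filter (fun k => k % 2 = r) (Finset.range (T / m + 1))).card ≤ 3 * (T / m : ℕ) := by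
            exact_mod_cast h2
          linarith
      _ ≤ 3/2 * (T / m) * sigsq := by gcongr
      _ = _ := by ring
  set V := 3/2 * sigsq * T / m with hVdef
  have hV0 : 0 ≤ V := by positivity
  set y := V / (ε * M) with hy
  have hy0 : 0 ≤ y := by positivity
  set x := 6 / (30 * y + 5) with hx
  have hx0 : 0 < x := by positivity
  have hx1 : x ≤ 6/5 := by
    rw [hx]; apply div_le_div_of_nonneg_left <;> linarith
  have hside : ∀ s : ℝ, |s| = 1 → μ.real {ω | ε < ∑ k ∈ Finset.range (T / m + 1), s * U k ω} ≤
      2 * Real.exp (ε / M * (-(67/200) * x) + 4/5 * x^2 * V / M^2) + 2 * (alphaMix μ Z T m * T / m) := by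
    intro s hs
    have hs2 : s ^ 2 = 1 := by rw [← sq_abs, hs]; norm_num
    have hsUb : ∀ k, ∀ᵐ ω ∂μ, |s * U k ω| ≤ M := by
      intro k; filter_upwards [hUb k] with ω h
      rw [abs_mul, hs, one_mul]; exact h
    refine one_sided F hFle hFmono (fun k ω => s * U k ω) (fun k => (hUm k).const_mul s)
      (fun k n h => (hUF k n h).const_mul s) M hM0 hsUb ?_ ε (by rw [hM]; linarith) x hx0 hx1 _ V ?_
      _ (by positivity) ?_
    · intro k; rw [integral_const_mul, hUmean, mul_zero]
    · intro r
      simp_rw [mul_pow, hs2, one_mul]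
      exact hV r
    · have hr : 0 ≤ Real.exp x - Real.exp (-x) := sub_nonneg.2 (Real.exp_le_exp.2 (by linarith))
      have hbot : ∀ k, k < 2 → ∫ ω, devP μ (F k) (fun ω => Real.exp (x / M * (s * U k ω))) ω ∂μ = 0 := by
        intro k hk
        have : F k = ⊥ := by
          have : k - 1 = 0 := by omega
          simp only [hF, this, zero_mul]
          exact sigmaGen_bot Z
        rw [this]
        simp [devP, condExp_bot]
      rw [Finset.sum_range_succ', hbot 0 (by norm_num), add_zero]
      calc _ ≤ ∑ k ∈ Finset.range (T / m), alphaMix μ Z T m * (Real.exp x - Real.exp (-x)) := by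
            apply Finset.sum_le_sum
            intro k hk
            rw [Finset.mem_range] at hk
            rcases Nat.eq_zero_or_pos k with rfl | hk0
            · rw [hbot _ (by norm_num)]; positivity
            · have hkT : (k + 1) * m ≤ T := (Nat.mul_le_mul_right m hk).trans (Nat.div_mul_le_self T m)
              have hkm : k * m + m ≤ T := by linarith
              have hkm1 : 1 ≤ k * m := Nat.mul_pos hk0 hm1
              have hbe : ∀ᵐ ω ∂μ, |x / M * (s * U (k+1) ω)| ≤ x := by
                filter_upwards [hsUb (k+1)] with ω h
                rw [abs_mul, abs_of_pos (div_pos hx0 hM0)]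
                calc _ ≤ x / M * M := by gcongr
                  _ = x := by field_simp
              refine condExp_dev (hFle _) (sigmaGen_le Z hmeas (k * m + m) T) ?_ _ _ _ ?_ ?_ ?_
              · apply Measurable.stronglyMeasurable
                apply Real.measurable_exp.comp
                refine ((hUS (k+1) (k * m + m) T ?_ (min_le_right _ _)).const_mul s).const_mul _
                rw [add_mul, one_mul]; omega
              · filter_upwards [hbe] with ω h
                exact Real.exp_le_exp.2 (abs_le.1 h).1
              · filter_upwards [hbe] with ω h
                exact Real.exp_le_exp.2 (abs_le.1 h).2
              · intro A B hA hB
                exact alphaMix_le μ Z T m (k * m) hkm1 hkm A B hA hB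
        _ = (T / m : ℕ) * (alphaMix μ Z T m * (Real.exp x - Real.exp (-x))) := by
            rw [Finset.sum_const, nsmul_eq_mul, Finset.card_range]
        _ ≤ (T / m) * (alphaMix μ Z T m * (Real.exp x - Real.exp (-x))) := by gcongr
        _ = _ := by ring
  have hsum : ∀ ω, ∑ i ∈ Finset.Icc 1 T, Z i ω = ∑ k ∈ Finset.range (T / m + 1), U k ω := by
    intro ω
    simp only [hU]
    rw [blocks_sum (fun i => Z i ω), min_eq_right]
    have := Nat.lt_div_mul_add (a := T) (b := m) (by omega)
    rw [add_mul, one_mul]; omega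
  have hexp : ε / M * (-(67/200) * x) + 4/5 * x^2 * V / M^2 ≤
      -ε ^ 2 / (64 * sigsq * T / m + 8 / 3 * ε * b * m) := by
    have h1 := mul_le_mul_of_nonneg_left (final_num y hy0) (by positivity : 0 ≤ ε / M)
    have h2 : 64 * sigsq * T / m + 8 / 3 * ε * b * m = ε * M * (128/3 * y + 8/3) := by
      have : 64 * sigsq * T / m = 128/3 * V := by rw [hVdef]; ring
      have h3 : 8 / 3 * ε * b * m = 8/3 * (ε * M) := by rw [hM]; ring
      rw [this, h3, hy]; field_simp
    have h3 : -ε ^ 2 / (64 * sigsq * T / m + 8 / 3 * ε * b * m) = ε / M * -(1/(128/3*y + 8/3)) := by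
      rw [h2]
      have : 0 < 128/3 * y + 8/3 := by positivity
      field_simp
    have h4 : ε / M * (-(67/200) * x) + 4/5 * x^2 * V / M^2 =
        ε / M * (-(67/200) * x + 4/5 * x^2 * y) := by
      have : V = y * (ε * M) := by rw [hy]; field_simp
      rw [this]; field_simp
    rw [h3, h4]; exact h1
  have hE := Real.exp_le_exp.2 hexp
  have hp := hside 1 (by simp)
  have hn := hside (-1) (by simp)
  have hsub : {ω | ε < |∑ i ∈ Finset.Icc 1 T, Z i ω|} ⊆
      {ω | ε < ∑ k ∈ Finset.range (T / m + 1), 1 * U k ω} ∪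
      {ω | ε < ∑ k ∈ Finset.range (T / m + 1), (-1) * U k ω} := by
    intro ω hω
    change ε < |∑ i ∈ Finset.Icc 1 T, Z i ω| at hω
    rw [hsum, lt_abs] at hω
    rcases hω with h | h
    · left; change ε < _; simpa using h
    · right; change ε < _; simpa using h
  have u1 := measureReal_mono (μ := μ) hsub (measure_ne_top μ _)
  have u2 := measureReal_union_le (μ := μ) {ω | ε < ∑ k ∈ Finset.range (T / m + 1), 1 * U k ω}
      {ω | ε < ∑ k ∈ Finset.range (T / m + 1), (-1) * U k ω}
  change μ.real {ω | ε < |∑ i ∈ Finset.Icc 1 T, Z i ω|} ≤ _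
  have e5 : 4 * alphaMix μ Z T m * T / m = 4 * (alphaMix μ Z T m * T / m) := by ring
  rw [e5]
  linarith
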